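/- arXiv:2501.06204 — 2 statements merged into one kernel-verified Lean document; each statement's English description precedes it below -/
import Mathlib

section
/- Let q and α be real numbers with 0 < q < 1 and α > 0. Then ψ_{q,α} is Lebesgue integrable on ℝ and ∫_ℝ ψ_{q,α}(x) dx = 1 (the continuous normalization property of the density function). -/
/-- The generalized hyperbolic tangent activation function. -/
noncomputable def h (q α x : ℝ) : ℝ :=
  (Real.exp (α * x) - q * Real.exp (-(α * x))) /
    ((1 + q) * Real.exp (α * x) + (1 - q) * Real.exp (-(α * x)))

/-- The associated density function. -/
noncomputable def ψ (q α x : ℝ) : ℝ :=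
  ((1 - q ^ 2) / (2 * (1 + q ^ 2))) * (h q α (x + 1) - h q α (x - 1))

open MeasureTheory Filter Topology

theorem integrable_and_integral_add_sub_sub_of_monotone {f : ℝ → ℝ} {l L c : ℝ}
    (hf : Monotone f) (hcont : Continuous f) (hbot : Tendsto f atBot (𝓝 l))
    (htop : Tendsto f atTop (𝓝 L)) (hc : 0 ≤ c) :
    Integrable (fun x => f (x + c) - f (x - c)) ∧
      ∫ x, (f (x + c) - f (x - c)) = 2 * c * (L - l) := by
  set F : ℝ → ℝ := fun x => ∫ t in (x - c)..(x + c), f t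
  have hint (a b : ℝ) : IntervalIntegrable f volume a b := hcont.intervalIntegrable a b
  have hderiv (x : ℝ) : HasDerivAt F (f (x + c) - f (x - c)) x := by
    have hF : F = fun y => (∫ t in (0 : ℝ)..(y + c), f t) - ∫ t in (0 : ℝ)..(y - c), f t := by
      funext y
      exact (intervalIntegral.integral_interval_sub_left (hint _ _) (hint _ _)).symm
    rw [hF]
    exact ((hcont.integral_hasStrictDerivAt 0 (x + c)).hasDerivAt.comp_add_const x c).sub
      ((hcont.integral_hasStrictDerivAt 0 (x - c)).hasDerivAt.comp_sub_const x c)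
  have hlower (x : ℝ) : 2 * c * f (x - c) ≤ F x := by
    have := intervalIntegral.integral_mono_on (a := x - c) (b := x + c) (by linarith)
      intervalIntegrable_const (hint _ _) fun t ht => hf ht.1
    rw [intervalIntegral.integral_const, smul_eq_mul] at this
    linarith
  have hupper (x : ℝ) : F x ≤ 2 * c * f (x + c) := by
    have := intervalIntegral.integral_mono_on (a := x - c) (b := x + c) (by linarith)
      (hint _ _) intervalIntegrable_const fun t ht => hf ht.2
    rw [intervalIntegral.integral_const, smul_eq_mul] at this
    linarith
  have hFbot : Tendsto F atBot (𝓝 (2 * c * l)) :=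
    tendsto_of_tendsto_of_tendsto_of_le_of_le
      ((hbot.comp (tendsto_atBot_add_const_right _ (-c) tendsto_id)).const_mul _)
      ((hbot.comp (tendsto_atBot_add_const_right _ c tendsto_id)).const_mul _) hlower hupper
  have hFtop : Tendsto F atTop (𝓝 (2 * c * L)) :=
    tendsto_of_tendsto_of_tendsto_of_le_of_le
      ((htop.comp (tendsto_atTop_add_const_right _ (-c) tendsto_id)).const_mul _)
      ((htop.comp (tendsto_atTop_add_const_right _ c tendsto_id)).const_mul _) hlower hupper
  have hnonneg (x : ℝ) : 0 ≤ f (x + c) - f (x - c) := sub_nonneg.2 (hf (by linarith))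
  have hcont' : Continuous fun x => f (x + c) - f (x - c) := by fun_prop
  have hintegrable : Integrable (fun x => f (x + c) - f (x - c)) := by
    refine integrable_of_intervalIntegral_norm_tendsto (2 * c * L - 2 * c * l)
      (fun i : ℝ => (hcont'.intervalIntegrable (-i) i).1) tendsto_neg_atTop_atBot tendsto_id ?_
    refine (hFtop.sub (hFbot.comp tendsto_neg_atTop_atBot)).congr fun i => ?_
    simp only [Real.norm_of_nonneg (hnonneg _)]
    exact (intervalIntegral.integral_eq_sub_of_hasDerivAt (fun x _ => hderiv x)
      (hcont'.intervalIntegrable _ _)).symm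
  refine ⟨hintegrable, ?_⟩
  rw [integral_of_hasDerivAt_of_tendsto hderiv hintegrable hFbot hFtop]
  ring

theorem h_eq_sub_div {q : ℝ} (hq0 : 0 < q) (hq1 : q < 1) (α x : ℝ) :
    h q α x = 1 / (1 + q) -
      (1 + q ^ 2) / (1 + q) / ((1 + q) * Real.exp (2 * α * x) + (1 - q)) := by
  have hexp : Real.exp (2 * α * x) = Real.exp (α * x) ^ 2 := by
    rw [← Real.exp_nat_mul]; congr 1; push_cast; ring
  have hpos := Real.exp_pos (α * x)
  have hq : 0 < 1 - q := sub_pos.2 hq1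
  rw [h, hexp, Real.exp_neg]
  generalize Real.exp (α * x) = y at hpos
  have hy : (1 + q) * y + (1 - q) * y⁻¹ = ((1 + q) * y ^ 2 + (1 - q)) / y := by field_simp
  have hden : (1 + q) * y ^ 2 + (1 - q) ≠ 0 := by positivity
  rw [hy]
  field_simp
  ring

theorem h_monotone {q α : ℝ} (hq0 : 0 < q) (hq1 : q < 1) (hα : 0 ≤ α) : Monotone (h q α) := by
  intro x y hxy
  have hq : 0 < 1 - q := sub_pos.2 hq1
  rw [h_eq_sub_div hq0 hq1, h_eq_sub_div hq0 hq1]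
  gcongr

theorem h_continuous {q : ℝ} (hq0 : 0 < q) (hq1 : q < 1) (α : ℝ) : Continuous (h q α) := by
  have hq : 0 < 1 - q := sub_pos.2 hq1
  unfold h
  exact Continuous.div (by fun_prop) (by fun_prop) fun x => by positivity

theorem h_tendsto_atTop {q α : ℝ} (hq0 : 0 < q) (hq1 : q < 1) (hα : 0 < α) :
    Tendsto (h q α) atTop (𝓝 (1 / (1 + q))) := by
  have hexp : Tendsto (fun x => Real.exp (2 * α * x)) atTop atTop :=
    Real.tendsto_exp_atTop.comp (tendsto_id.const_mul_atTop (by positivity))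
  have hden := tendsto_atTop_add_const_right _ (1 - q)
    (hexp.const_mul_atTop (show 0 < 1 + q by positivity))
  rw [funext (h_eq_sub_div hq0 hq1 α)]
  simpa using (hden.const_div_atTop ((1 + q ^ 2) / (1 + q))).const_sub (1 / (1 + q))

theorem h_tendsto_atBot {q α : ℝ} (hq0 : 0 < q) (hq1 : q < 1) (hα : 0 < α) :
    Tendsto (h q α) atBot (𝓝 (-q / (1 - q))) := by
  have hq : 1 - q ≠ 0 := (sub_pos.2 hq1).ne'
  have hexp : Tendsto (fun x => Real.exp (2 * α * x)) atBot (𝓝 0) :=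
    Real.tendsto_exp_atBot.comp (tendsto_id.const_mul_atBot (by positivity))
  have hden : Tendsto (fun x => (1 + q) * Real.exp (2 * α * x) + (1 - q)) atBot (𝓝 (1 - q)) := by
    simpa using (hexp.const_mul (1 + q)).add_const (1 - q)
  have hlim : -q / (1 - q) = 1 / (1 + q) - (1 + q ^ 2) / (1 + q) / (1 - q) := by
    field_simp
    ring
  rw [funext (h_eq_sub_div hq0 hq1 α), hlim]
  exact (tendsto_const_nhds.div hden hq).const_sub _

theorem psi_integrable_integral_one (q α : ℝ) (hq0 : 0 < q) (hq1 : q < 1) (hα : 0 < α) :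
    MeasureTheory.Integrable (ψ q α) ∧ ∫ x : ℝ, ψ q α x = 1 := by
  obtain ⟨hint, heq⟩ := integrable_and_integral_add_sub_sub_of_monotone
    (h_monotone hq0 hq1 hα.le) (h_continuous hq0 hq1 α) (h_tendsto_atBot hq0 hq1 hα)
    (h_tendsto_atTop hq0 hq1 hα) zero_le_one
  refine ⟨hint.const_mul _, ?_⟩
  have hq : 1 - q ≠ 0 := (sub_pos.2 hq1).ne'
  simp only [ψ]
  rw [integral_const_mul, heq]
  field_simp
  ring
end

section
/- (Voronovskaya-type asymptotic expansion for the quasi-interpolation operator.) Let q and α be real numbers with 0 < q < 1 and α > 0, let m ≥ 1 be a natural number, and let f : ℝ → ℝ be m times continuously differentiable with f^{(j)} bounded on ℝ for every 0 ≤ j ≤ m. Then there exists a constant C > 0 (depending on f, q, α, m) such that for every positive integer n and every x ∈ ℝ: | A_n(f; x) − f(x) − Σ_{j=1}^{m−1} (f^{(j)}(x)/j!) · ( Σ_{k ∈ ℤ} (k/n − x)^j · ψ_{q,α}(n x − k) ) | ≤ C / n^m. In particular A_n(f; x) − f(x) equals the sum of the derivative correction terms up to order m−1 plus an error of size O(1/n^m).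 -/
/-- The quasi-interpolation neural network operator. -/
noncomputable def A (q α : ℝ) (n : ℕ) (f : ℝ → ℝ) (x : ℝ) : ℝ :=
  ∑' k : ℤ, f (k / n) * ψ q α (n * x - k)

/-- The Kantorovich-type neural network operator. -/
noncomputable def K (q α : ℝ) (n : ℕ) (f : ℝ → ℝ) (x : ℝ) : ℝ :=
  ∑' k : ℤ, ((n : ℝ) * ∫ t in ((k : ℝ) / n)..(((k : ℝ) + 1) / n), f t) * ψ q α (n * x - k)

open Filter Topology in
/-- Telescoping series over the integers. -/
theorem hasSum_int_telescope {u : ℤ → ℝ} {a b : ℝ} (hs : Summable fun k => u (k + 1) - u k)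
    (ha : Tendsto u atTop (𝓝 a)) (hb : Tendsto u atBot (𝓝 b)) :
    HasSum (fun k => u (k + 1) - u k) (a - b) := by
  have hpos : HasSum (fun n : ℕ => u ((n : ℤ) + 1) - u n) (a - u 0) := by
    have hs' : Summable fun n : ℕ => u ((n : ℤ) + 1) - u n :=
      hs.comp_injective Nat.cast_injective
    rw [hs'.hasSum_iff_tendsto_nat]
    have hsum (N : ℕ) : ∑ n ∈ Finset.range N, (u ((n : ℤ) + 1) - u n) = u N - u 0 := by
      simpa using Finset.sum_range_sub (fun n : ℕ => u n) N
    exact (((ha.comp tendsto_natCast_atTop_atTop).sub_const (u 0))).congr fun N => (hsum N).symm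
  have hneg : HasSum (fun n : ℕ => u (-((n : ℤ) + 1) + 1) - u (-((n : ℤ) + 1))) (u 0 - b) := by
    have hinj : Function.Injective fun n : ℕ => -((n : ℤ) + 1) := fun i j hij => by
      simpa using hij
    have hs' : Summable fun n : ℕ => u (-((n : ℤ) + 1) + 1) - u (-((n : ℤ) + 1)) :=
      hs.comp_injective hinj
    rw [hs'.hasSum_iff_tendsto_nat]
    have hsum (N : ℕ) : ∑ n ∈ Finset.range N,
        (u (-((n : ℤ) + 1) + 1) - u (-((n : ℤ) + 1))) = u 0 - u (-N) := by
      simpa using Finset.sum_range_sub' (fun n : ℕ => u (-n)) N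
    have hlim : Tendsto (fun N : ℕ => -(N : ℤ)) atTop atBot :=
      tendsto_neg_atTop_atBot.comp tendsto_natCast_atTop_atTop
    exact ((hb.comp hlim).const_sub (u 0)).congr fun N => (hsum N).symm
  rw [← sub_add_sub_cancel a (u 0) b]
  exact HasSum.of_nat_of_neg_add_one (f := fun k => u (k + 1) - u k) hpos hneg

theorem summable_exp_neg_mul_abs_int {α : ℝ} (hα : 0 < α) :
    Summable fun k : ℤ => Real.exp (-(α * |(k : ℝ)|)) := by
  have hnat : Summable fun n : ℕ => Real.exp (-(α * n)) := by
    simpa [mul_comm] using Real.summable_exp_nat_mul_iff.2 (neg_neg_of_pos hα)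
  apply Summable.of_nat_of_neg <;> simpa using hnat

section Activation

variable {q α : ℝ}

theorem h_denom_pos (hq0 : 0 < q) (hq1 : q < 1) (x : ℝ) :
    0 < (1 + q) * Real.exp (α * x) + (1 - q) * Real.exp (-(α * x)) := by
  have := sub_pos.2 hq1
  positivity

theorem abs_h_sub_right_limit_le (hq0 : 0 < q) (hq1 : q < 1) (x : ℝ) :
    |h q α x - 1 / (1 + q)| ≤ 2 * Real.exp (-(2 * α * x)) := by
  have hD := h_denom_pos (α := α) hq0 hq1 x
  have heq : h q α x - 1 / (1 + q) = -((1 + q ^ 2) / (1 + q) * (Real.exp (-(α * x)) /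
      ((1 + q) * Real.exp (α * x) + (1 - q) * Real.exp (-(α * x))))) := by
    have := hD.ne'
    rw [h, div_sub_div _ _ this (by positivity), div_mul_div_comm, ← neg_div,
      mul_comm (1 + q) (_ + _)]
    congr 1
    ring
  have hexp : Real.exp (-(2 * α * x)) * Real.exp (α * x) = Real.exp (-(α * x)) := by
    rw [← Real.exp_add]; ring_nf
  have hcoef : (1 + q ^ 2) / (1 + q) ≤ 2 := by
    rw [div_le_iff₀ (by linarith)]; nlinarith
  have hfrac : Real.exp (-(α * x)) /
      ((1 + q) * Real.exp (α * x) + (1 - q) * Real.exp (-(α * x))) ≤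
      Real.exp (-(2 * α * x)) := by
    rw [div_le_iff₀ hD]
    have h1 : 0 ≤ Real.exp (-(2 * α * x)) * (q * Real.exp (α * x)) := by positivity
    have h2 : 0 ≤ Real.exp (-(2 * α * x)) * ((1 - q) * Real.exp (-(α * x))) := by
      have := sub_pos.2 hq1
      positivity
    linarith
  rw [heq, abs_neg, abs_of_nonneg (by positivity)]
  gcongr

theorem abs_h_sub_left_limit_le (hq0 : 0 < q) (hq1 : q < 1) (x : ℝ) :
    |h q α x - -q / (1 - q)| ≤ 2 / (1 - q) ^ 2 * Real.exp (2 * α * x) := by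
  have hD := h_denom_pos (α := α) hq0 hq1 x
  have hq' := sub_pos.2 hq1
  have heq : h q α x - -q / (1 - q) = (1 + q ^ 2) / (1 - q) * (Real.exp (α * x) /
      ((1 + q) * Real.exp (α * x) + (1 - q) * Real.exp (-(α * x)))) := by
    rw [h]
    field_simp
    ring
  have hexp : Real.exp (2 * α * x) * Real.exp (-(α * x)) = Real.exp (α * x) := by
    rw [← Real.exp_add]; ring_nf
  have hcoef : (1 + q ^ 2) / (1 - q) ≤ 2 / (1 - q) := by
    gcongr; nlinarith
  have hfrac : Real.exp (α * x) /
      ((1 + q) * Real.exp (α * x) + (1 - q) * Real.exp (-(α * x))) ≤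
      1 / (1 - q) * Real.exp (2 * α * x) := by
    rw [div_le_iff₀ hD]
    have h1 : 0 ≤ 1 / (1 - q) * Real.exp (2 * α * x) * ((1 + q) * Real.exp (α * x)) := by
      positivity
    have h2 : 1 / (1 - q) * Real.exp (2 * α * x) * ((1 - q) * Real.exp (-(α * x))) =
        Real.exp (α * x) := by
      rw [← hexp]; field_simp
    linarith
  rw [heq, abs_of_nonneg (by positivity)]
  calc _ ≤ 2 / (1 - q) * (1 / (1 - q) * Real.exp (2 * α * x)) := by gcongr
    _ = _ := by field_simp

open Filter Topology in
theorem tendsto_h_atTop (hq0 : 0 < q) (hq1 : q < 1) (hα : 0 < α) :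
    Tendsto (h q α) atTop (𝓝 (1 / (1 + q))) := by
  rw [tendsto_iff_norm_sub_tendsto_zero]
  refine squeeze_zero (fun _ => norm_nonneg _) (abs_h_sub_right_limit_le hq0 hq1) ?_
  have hlin : Tendsto (fun x : ℝ => 2 * α * x) atTop atTop :=
    tendsto_id.const_mul_atTop (by positivity)
  simpa using (Real.tendsto_exp_neg_atTop_nhds_zero.comp hlin).const_mul 2

open Filter Topology in
theorem tendsto_h_atBot (hq0 : 0 < q) (hq1 : q < 1) (hα : 0 < α) :
    Tendsto (h q α) atBot (𝓝 (-q / (1 - q))) := by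
  rw [tendsto_iff_norm_sub_tendsto_zero]
  refine squeeze_zero (fun _ => norm_nonneg _) (abs_h_sub_left_limit_le hq0 hq1) ?_
  have hlin : Tendsto (fun x : ℝ => 2 * α * x) atBot atBot :=
    tendsto_id.const_mul_atBot (by positivity)
  simpa using (Real.tendsto_exp_atBot.comp hlin).const_mul (2 / (1 - q) ^ 2)

/-- The density decays exponentially. -/
theorem exists_abs_ψ_le (hq0 : 0 < q) (hq1 : q < 1) (hα : 0 < α) :
    ∃ B : ℝ, 0 ≤ B ∧ ∀ x, |ψ q α x| ≤ B * Real.exp (-(2 * α * |x|)) := by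
  have hq' := sub_pos.2 hq1
  set c := (1 - q ^ 2) / (2 * (1 + q ^ 2)) with hc
  set D := max 2 (2 / (1 - q) ^ 2)
  refine ⟨|c| * (2 * D * Real.exp (2 * α)), by positivity, fun x => ?_⟩
  rw [ψ, ← hc, abs_mul, mul_assoc]
  gcongr
  have hle {s t : ℝ} (hst : s ≤ 2 * α - 2 * α * |x|) (htD : t ≤ D) :
      t * Real.exp s ≤ D * (Real.exp (2 * α) * Real.exp (-(2 * α * |x|))) := by
    rw [← Real.exp_add]
    have : Real.exp s ≤ Real.exp (2 * α + -(2 * α * |x|)) := Real.exp_le_exp.2 (by linarith)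
    gcongr
  rcases le_total 0 x with hx | hx
  · have h1 := abs_h_sub_right_limit_le (α := α) hq0 hq1 (x + 1)
    have h2 := abs_h_sub_right_limit_le (α := α) hq0 hq1 (x - 1)
    have e1 := hle (s := -(2 * α * (x + 1))) (by rw [abs_of_nonneg hx]; linarith)
      (le_max_left _ _)
    have e2 := hle (s := -(2 * α * (x - 1))) (by rw [abs_of_nonneg hx]; linarith)
      (le_max_left _ _)
    have := abs_sub_le (h q α (x + 1)) (1 / (1 + q)) (h q α (x - 1))
    rw [abs_sub_comm (1 / (1 + q))] at this
    linarith
  · have h1 := abs_h_sub_left_limit_le (α := α) hq0 hq1 (x + 1)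
    have h2 := abs_h_sub_left_limit_le (α := α) hq0 hq1 (x - 1)
    have e1 := hle (s := 2 * α * (x + 1)) (by rw [abs_of_nonpos hx]; linarith)
      (le_max_right _ _)
    have e2 := hle (s := 2 * α * (x - 1)) (by rw [abs_of_nonpos hx]; linarith)
      (le_max_right _ _)
    have := abs_sub_le (h q α (x + 1)) (-q / (1 - q)) (h q α (x - 1))
    rw [abs_sub_comm (-q / (1 - q))] at this
    linarith

/-- The absolute lattice moments of the density are dominated by a summable family, uniformly
up to integer shifts. -/
theorem exists_abs_pow_mul_abs_ψ_le (hq0 : 0 < q) (hq1 : q < 1) (hα : 0 < α) (j : ℕ) :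
    ∃ B : ℝ, 0 ≤ B ∧ ∀ (y : ℝ) (k : ℤ), |y - k| ^ j * |ψ q α (y - k)| ≤
      B * Real.exp (-(α * |((⌊y⌋ - k : ℤ) : ℝ)|)) := by
  obtain ⟨B, hB, hψ⟩ := exists_abs_ψ_le hq0 hq1 hα
  refine ⟨j.factorial / α ^ j * B * Real.exp α, by positivity, fun y k => ?_⟩
  set z := y - k with hz
  have hpow : |z| ^ j ≤ j.factorial / α ^ j * Real.exp (α * |z|) := by
    have := Real.pow_div_factorial_le_exp (α * |z|) (by positivity) j
    rw [mul_pow, div_le_iff₀ (by positivity)] at this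
    rw [div_mul_eq_mul_div, le_div_iff₀ (by positivity)]
    linarith
  have habs : |((⌊y⌋ - k : ℤ) : ℝ)| ≤ |z| + 1 := by
    have hfl := Int.floor_le y
    have hlt := Int.lt_floor_add_one y
    have := abs_sub_abs_le_abs_sub ((⌊y⌋ - k : ℤ) : ℝ) z
    have : |((⌊y⌋ - k : ℤ) : ℝ) - z| ≤ 1 := by
      rw [abs_le, hz]; push_cast; constructor <;> linarith
    linarith
  calc |z| ^ j * |ψ q α z|
      ≤ (j.factorial / α ^ j * Real.exp (α * |z|)) * (B * Real.exp (-(2 * α * |z|))) := by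
        gcongr
        exact hψ z
    _ = j.factorial / α ^ j * B * Real.exp (-(α * |z|)) := by
        have : Real.exp (-(α * |z|)) = Real.exp (α * |z|) * Real.exp (-(2 * α * |z|)) := by
          rw [← Real.exp_add]; ring_nf
        rw [this]; ring
    _ ≤ j.factorial / α ^ j * B *
        (Real.exp α * Real.exp (-(α * |((⌊y⌋ - k : ℤ) : ℝ)|))) := by
        rw [← Real.exp_add]
        gcongr
        nlinarith
    _ = _ := by ring

/-- The lattice moments of the density converge absolutely and are uniformly bounded. -/
theorem exists_tsum_abs_pow_mul_abs_ψ_le (hq0 : 0 < q) (hq1 : q < 1) (hα : 0 < α) (j : ℕ) :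
    ∃ B : ℝ, ∀ y : ℝ, (Summable fun k : ℤ => |y - k| ^ j * |ψ q α (y - k)|) ∧
      ∑' k : ℤ, |y - k| ^ j * |ψ q α (y - k)| ≤ B := by
  obtain ⟨B, hB, hle⟩ := exists_abs_pow_mul_abs_ψ_le hq0 hq1 hα j
  have hsum := summable_exp_neg_mul_abs_int hα
  refine ⟨B * ∑' k : ℤ, Real.exp (-(α * |(k : ℝ)|)), fun y => ?_⟩
  have hshift : Summable fun k : ℤ => B * Real.exp (-(α * |((⌊y⌋ - k : ℤ) : ℝ)|)) :=
    (hsum.comp_injective (Equiv.subLeft ⌊y⌋).injective).mul_left B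
  have hmom := Summable.of_nonneg_of_le (fun k => by positivity) (hle y) hshift
  refine ⟨hmom, (hmom.tsum_le_tsum (hle y) hshift).trans_eq ?_⟩
  rw [tsum_mul_left]
  congr 1
  exact (Equiv.subLeft ⌊y⌋).tsum_eq fun k : ℤ => Real.exp (-(α * |(k : ℝ)|))

open Filter Topology in
/-- The integer translates of the density form a partition of unity. -/
theorem hasSum_ψ (hq0 : 0 < q) (hq1 : q < 1) (hα : 0 < α) (y : ℝ) :
    HasSum (fun k : ℤ => ψ q α (y - k)) 1 := by
  have hq' := sub_pos.2 hq1
  obtain ⟨B, hB⟩ := exists_tsum_abs_pow_mul_abs_ψ_le hq0 hq1 hα 0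
  have hsum : Summable fun k : ℤ => ψ q α (y - k) := by
    simpa using (hB y).1.of_norm_bounded (f := fun k : ℤ => ψ q α (y - k))
      (fun k => by simp)
  set c := (1 - q ^ 2) / (2 * (1 + q ^ 2)) with hc
  let u : ℤ → ℝ := fun k => -(c * (h q α (y - k + 1) + h q α (y - k)))
  have hu (k : ℤ) : u (k + 1) - u k = ψ q α (y - k) := by
    simp only [u, ψ, ← hc]
    push_cast
    rw [show y - (k + 1) + 1 = y - k by ring, show y - ((k : ℝ) + 1) = y - k - 1 by ring]
    ring
  have hlim {l : Filter ℝ} {L : ℝ} {s : Filter ℤ} (hL : Tendsto (h q α) l (𝓝 L))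
      (h0 : Tendsto (fun k : ℤ => y - (k : ℝ)) s l)
      (h1 : Tendsto (fun k : ℤ => y - (k : ℝ) + 1) s l) :
      Tendsto u s (𝓝 (-(c * (L + L)))) :=
    (((hL.comp h1).add (hL.comp h0)).const_mul c).neg
  have htop : Tendsto (fun k : ℤ => y - (k : ℝ)) atTop atBot :=
    tendsto_atBot_add_const_left _ y
      (tendsto_neg_atTop_atBot.comp tendsto_intCast_atTop_atTop)
  have hbot : Tendsto (fun k : ℤ => y - (k : ℝ)) atBot atTop :=
    tendsto_atTop_add_const_left _ y
      (tendsto_neg_atBot_atTop.comp (tendsto_intCast_atBot_iff.2 tendsto_id))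
  have hval : -(c * (-q / (1 - q) + -q / (1 - q))) - -(c * (1 / (1 + q) + 1 / (1 + q))) = 1 := by
    rw [hc]
    field_simp
    ring
  have := hasSum_int_telescope (by simpa only [hu] using hsum)
    (hlim (tendsto_h_atBot hq0 hq1 hα) htop (tendsto_atBot_add_const_right _ 1 htop))
    (hlim (tendsto_h_atTop hq0 hq1 hα) hbot (tendsto_atTop_add_const_right _ 1 hbot))
  simpa only [hu, hval] using this

end Activation

/-- Taylor's theorem with a global bound on the top derivative. -/
theorem abs_sub_taylor_le {f : ℝ → ℝ} {p : ℕ} (hf : ContDiff ℝ ((p + 1 : ℕ) : ℕ∞) f) {M : ℝ}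
    (hM : ∀ x, |iteratedDeriv (p + 1) f x| ≤ M) (x t : ℝ) :
    |f t - ∑ j ∈ Finset.range (p + 1), iteratedDeriv j f x / j.factorial * (t - x) ^ j| ≤
      M * |t - x| ^ (p + 1) := by
  have hM0 : 0 ≤ M := (abs_nonneg _).trans (hM 0)
  rcases eq_or_ne x t with rfl | hne
  · simp [Finset.sum_range_succ']
  obtain ⟨z, -, hz⟩ := taylor_mean_remainder_lagrange_iteratedDeriv (n := p) hne
    (by exact_mod_cast hf.contDiffOn)
  have hpoly : taylorWithinEval f p (Set.uIcc x t) x t =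
      ∑ j ∈ Finset.range (p + 1), iteratedDeriv j f x / j.factorial * (t - x) ^ j := by
    rw [taylor_within_apply]
    refine Finset.sum_congr rfl fun j hj => ?_
    rw [iteratedDerivWithin_eq_iteratedDeriv (uniqueDiffOn_uIcc hne)
      (hf.contDiffAt.of_le ?_) Set.left_mem_uIcc, smul_eq_mul]
    · ring
    · have := Finset.mem_range.1 hj
      exact_mod_cast this.le
  rw [← hpoly, hz, abs_div, abs_mul, abs_pow, Nat.abs_cast]
  have hfac : (1 : ℝ) ≤ ((p + 1).factorial : ℝ) := by
    exact_mod_cast Nat.one_le_iff_ne_zero.2 (Nat.factorial_ne_zero _)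
  refine (div_le_self (by positivity) hfac).trans ?_
  gcongr
  exact hM z

theorem voronovskaya_expansion (q α : ℝ) (hq0 : 0 < q) (hq1 : q < 1) (hα : 0 < α)
    (m : ℕ) (hm : 1 ≤ m) (f : ℝ → ℝ) (hf : ContDiff ℝ (m : ℕ∞) f)
    (hbd : ∀ j : ℕ, j ≤ m → ∃ M : ℝ, ∀ x : ℝ, |iteratedDeriv j f x| ≤ M) :
    ∃ C : ℝ, 0 < C ∧ ∀ n : ℕ, 0 < n → ∀ x : ℝ,
      |A q α n f x - f x -
        ∑ j ∈ Finset.Icc 1 (m - 1),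
          (iteratedDeriv j f x / (Nat.factorial j)) *
            (∑' k : ℤ, ((k : ℝ) / n - x) ^ j * ψ q α (n * x - k))| ≤ C / n ^ m := by
  obtain ⟨p, rfl⟩ : ∃ p, m = p + 1 := ⟨m - 1, by omega⟩
  obtain ⟨M, hM⟩ := hbd (p + 1) le_rfl
  obtain ⟨M₀, hM₀⟩ := hbd 0 (Nat.zero_le _)
  obtain ⟨B, hB⟩ := exists_tsum_abs_pow_mul_abs_ψ_le hq0 hq1 hα (p + 1)
  have hM0 : 0 ≤ M := (abs_nonneg _).trans (hM 0)
  have hB0 : 0 ≤ B := (tsum_nonneg fun k => by positivity).trans (hB 0).2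
  refine ⟨M * B + 1, by positivity, fun n hn x => ?_⟩
  have hn' : (0 : ℝ) < n := Nat.cast_pos.2 hn
  have hscale (k : ℤ) : |(k : ℝ) / n - x| = |n * x - k| / n := by
    rw [abs_sub_comm, show x - k / n = (n * x - k) / n by field_simp, abs_div, abs_of_pos hn']
  have hmoment (j : ℕ) : Summable fun k : ℤ => ((k : ℝ) / n - x) ^ j * ψ q α (n * x - k) := by
    obtain ⟨_, hj⟩ := exists_tsum_abs_pow_mul_abs_ψ_le hq0 hq1 hα j
    refine ((hj (n * x)).1.div_const ((n : ℝ) ^ j)).of_norm_bounded fun k => ?_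
    rw [Real.norm_eq_abs, abs_mul, abs_pow, hscale, div_pow]
    exact (div_mul_eq_mul_div _ _ _).le
  have hA : Summable fun k : ℤ => f (k / n) * ψ q α (n * x - k) := by
    obtain ⟨_, h0⟩ := exists_tsum_abs_pow_mul_abs_ψ_le hq0 hq1 hα 0
    refine ((h0 (n * x)).1.mul_left M₀).of_norm_bounded fun k => ?_
    rw [norm_mul, pow_zero, one_mul]
    have := hM₀ (k / n)
    rw [iteratedDeriv_zero] at this
    exact mul_le_mul_of_nonneg_right this (abs_nonneg _)
  let P : ℤ → ℝ := fun k =>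
    ∑ j ∈ Finset.range (p + 1), iteratedDeriv j f x / j.factorial * ((k : ℝ) / n - x) ^ j
  have hP : HasSum (fun k : ℤ => P k * ψ q α (n * x - k))
      (f x + ∑ j ∈ Finset.Icc 1 p, iteratedDeriv j f x / j.factorial *
        ∑' k : ℤ, ((k : ℝ) / n - x) ^ j * ψ q α (n * x - k)) := by
    have hsum := hasSum_sum (s := Finset.range (p + 1)) fun j _ =>
      (hmoment j).hasSum.mul_left (iteratedDeriv j f x / j.factorial)
    simp only [P, Finset.sum_mul, mul_assoc]
    convert! hsum using 1
    rw [Finset.range_eq_Ico, Finset.sum_eq_sum_Ico_succ_bot (Nat.succ_pos p)]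
    simp [(hasSum_ψ hq0 hq1 hα (n * x)).tsum_eq]
    rfl
  have hdiff := hA.hasSum.sub hP
  have hbound (k : ℤ) :
      ‖f (k / n) * ψ q α (n * x - k) - P k * ψ q α (n * x - k)‖ ≤
        M / n ^ (p + 1) * (|n * x - k| ^ (p + 1) * |ψ q α (n * x - k)|) := by
    rw [← sub_mul, norm_mul, Real.norm_eq_abs, Real.norm_eq_abs]
    calc _ ≤ M * |(k : ℝ) / n - x| ^ (p + 1) * |ψ q α (n * x - k)| := by
          gcongr
          exact abs_sub_taylor_le hf hM x (k / n)
      _ = _ := by rw [hscale, div_pow]; ring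
  have hle := tsum_of_norm_bounded ((hB (n * x)).1.hasSum.mul_left (M / (n : ℝ) ^ (p + 1))) hbound
  rw [hdiff.tsum_eq, Real.norm_eq_abs] at hle
  rw [Nat.add_sub_cancel, A, sub_sub]
  calc _ ≤ _ := hle
    _ ≤ M / n ^ (p + 1) * B := by
        gcongr
        exact (hB (n * x)).2
    _ = M * B / n ^ (p + 1) := by ring
    _ ≤ _ := by gcongr; linarith
end
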